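/- Let R be a one-dimensional Gorenstein complete Noetherian local ring which is not regular, with maximal ideal m and total quotient ring Q = Q(R). Let 𝔭 be a minimal prime of R, R' = R/𝔭, Q' = Q(R'), π : Q → Q' the canonical surjection via Q/𝔭Q ≅ Q', and R̄' the integral closure of R' in Q'. Suppose γ̃' ∈ Q satisfies π(γ̃')·m_{R̄'} ⊆ R' and π(γ̃') ∉ R', and z ∈ R satisfies Ann_R(z) = 𝔭; set γ = z·γ̃' and assume γ ∉ R. Let M be an indecomposable finitely generated maximal Cohen-Macaulay R-module which is not free and such that M_𝔮 is a free R_𝔮-module for every nonmaximal prime 𝔮. Then there exists g ∈ End_R(M) such that g ⊗_R Q equals multiplication by γ on M ⊗_R Q; and for any such g and any h ∈ End_R(M) which is not an automorphism, the composite h ∘ g factors through a finitely generated free R-module. -/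

import Mathlib

open CategoryTheory CategoryTheory.Abelian

universe u

/-- The depth of a module `M` over a Noetherian local ring `R`: the supremum of the lengths
of `M`-regular sequences consisting of elements of the maximal ideal. -/
noncomputable def moduleDepth (R : Type*) [CommRing R] [IsLocalRing R]
    (M : Type*) [AddCommGroup M] [Module R M] : ℕ∞ :=
  ⨆ (rs : List R) (_ : RingTheory.Sequence.IsRegular M rs)
    (_ : ∀ r ∈ rs, r ∈ IsLocalRing.maximalIdeal R), (rs.length : ℕ∞)

/-- A Noetherian local ring `R` is Gorenstein if it is Cohen-Macaulay (`depth R = dim R`)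
and `Ext^{dim R}_R(k, R)` is one-dimensional over the residue field `k`; for
one-dimensional `R` the latter says that `Ext¹_R(k, R)` is nonzero and cyclic for the
action of `R` by composition (it is annihilated by the maximal ideal, so this means exactly
that it is a one-dimensional `k`-vector space). -/
def IsGorensteinOneDim (R : Type u) [CommRing R] [IsLocalRing R]
    [HasExt.{u} (ModuleCat.{u} R)] : Prop :=
  (moduleDepth R R : WithBot ℕ∞) = ringKrullDim R ∧
  ∃ e : Ext (ModuleCat.of R (IsLocalRing.ResidueField R)) (ModuleCat.of R R) 1, e ≠ 0 ∧
    ∀ e' : Ext (ModuleCat.of R (IsLocalRing.ResidueField R)) (ModuleCat.of R R) 1,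
      ∃ r : R, e' = e.comp (Ext.mk₀ (r • 𝟙 (ModuleCat.of R R))) (add_zero 1)

/-- A Noetherian local ring is regular if its maximal ideal can be generated by
`dim R` many elements. -/
def IsRegularLocal (R : Type*) [CommRing R] [IsLocalRing R] : Prop :=
  ∃ s : Finset R, Ideal.span (s : Set R) = IsLocalRing.maximalIdeal R ∧
    (s.card : WithBot ℕ∞) = ringKrullDim R

/-- A module is indecomposable if it is nonzero and is not the (internal) direct sum of two
nonzero submodules. -/
def IsIndecomposableModule (R : Type*) [CommRing R] (M : Type*) [AddCommGroup M]
    [Module R M] : Prop :=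
  Nontrivial M ∧ ¬∃ (N₁ N₂ : Submodule R M), IsCompl N₁ N₂ ∧ N₁ ≠ ⊥ ∧ N₂ ≠ ⊥


section OneDim

variable {R : Type*} [CommRing R] [IsLocalRing R]

lemma eq_maximalIdeal_of_mem_nonZeroDivisors [Ring.KrullDimLE 1 R] {b : R}
    (hb : b ∈ nonZeroDivisors R) (q : Ideal R) [hq : q.IsPrime] (hbq : b ∈ q) :
    q = IsLocalRing.maximalIdeal R := by
  rcases Ring.krullDimLE_one_iff.mp ‹_› q hq with h | h
  · exact absurd hb (notMem_nonZeroDivisors_of_mem_mem_minimalPrimes hbq h)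
  · exact IsLocalRing.eq_maximalIdeal h

lemma exists_pow_mem_span_of_nonZeroDivisors [Ring.KrullDimLE 1 R] {b y : R}
    (hb : b ∈ nonZeroDivisors R) (hy : y ∈ IsLocalRing.maximalIdeal R) :
    ∃ n : ℕ, y ^ n ∈ Ideal.span {b} := by
  have : y ∈ (Ideal.span {b}).radical := by
    rw [Ideal.radical_eq_sInf, Submodule.mem_sInf]
    rintro q ⟨hq, hq'⟩
    rwa [eq_maximalIdeal_of_mem_nonZeroDivisors hb q (hq (Ideal.mem_span_singleton_self b))]
  exact this

lemma exists_isSMulRegular_of_moduleDepth_eq_one {M : Type*} [AddCommGroup M] [Module R M]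
    (h : (moduleDepth R M : WithBot ℕ∞) = 1) :
    ∃ x ∈ IsLocalRing.maximalIdeal R, IsSMulRegular M x := by
  by_contra! H
  have h0 : moduleDepth R M ≤ 0 := by
    refine iSup_le fun rs => iSup_le fun h1 => iSup_le fun h2 => ?_
    match rs with
    | [] => simp
    | x :: rs =>
      exact absurd ((RingTheory.Sequence.isRegular_cons_iff M x rs).mp h1).1
        (H x (h2 x (by simp)))
  have h1 : moduleDepth R M = 1 := by exact_mod_cast h
  rw [h1] at h0
  simp at h0

lemma isSMulRegular_of_mem_nonZeroDivisors [Ring.KrullDimLE 1 R] {M : Type*} [AddCommGroup M]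
    [Module R M] {y b : R} (hy : y ∈ IsLocalRing.maximalIdeal R) (hyM : IsSMulRegular M y)
    (hb : b ∈ nonZeroDivisors R) : IsSMulRegular M b := by
  obtain ⟨n, hn⟩ := exists_pow_mem_span_of_nonZeroDivisors hb hy
  obtain ⟨s, hs⟩ := Ideal.mem_span_singleton'.mp hn
  have := hyM.pow n
  rw [← hs] at this
  exact IsSMulRegular.of_mul this

lemma isFiniteLength_quotient_span [IsNoetherianRing R] [Ring.KrullDimLE 1 R] {b : R}
    (hb : b ∈ nonZeroDivisors R) : IsFiniteLength R (R ⧸ Ideal.span {b}) := by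
  have : Ring.KrullDimLE 0 (R ⧸ Ideal.span {b}) := .mk₀ fun I hI => by
    have h : I.comap (Ideal.Quotient.mk (Ideal.span {b})) = IsLocalRing.maximalIdeal R := by
      refine eq_maximalIdeal_of_mem_nonZeroDivisors hb _ ?_
      rw [Ideal.mem_comap, Ideal.Quotient.eq_zero_iff_mem.mpr (Ideal.mem_span_singleton_self b)]
      exact I.zero_mem
    rw [← Ideal.map_comap_of_surjective _ Ideal.Quotient.mk_surjective I, h]
    refine (Ideal.map_eq_top_or_isMaximal_of_surjective _ Ideal.Quotient.mk_surjective
      (IsLocalRing.maximalIdeal.isMaximal R)).resolve_left fun h' => hI.ne_top ?_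
    rw [← Ideal.map_comap_of_surjective _ Ideal.Quotient.mk_surjective I, h, h']
  have : IsArtinianRing (R ⧸ Ideal.span {b}) :=
    isArtinianRing_iff_isNoetherianRing_krullDimLE_zero.mpr ⟨inferInstance, this⟩
  rw [isFiniteLength_iff_isNoetherian_isArtinian]
  exact ⟨inferInstance, isArtinian_of_surjective_algebraMap (R := R ⧸ Ideal.span {b})
    Ideal.Quotient.mk_surjective⟩

end OneDim

section Gorenstein

lemma length_hom_residueField_le_one {R : Type u} [CommRing R] [IsLocalRing R]
    [HasExt.{u} (ModuleCat.{u} R)] (hGor : IsGorensteinOneDim R) {x : R}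
    (hx : x ∈ nonZeroDivisors R) (hxm : x ∈ IsLocalRing.maximalIdeal R) :
    Module.length R (IsLocalRing.ResidueField R →ₗ[R] R ⧸ Ideal.span {x}) ≤ 1 := by
  let k := IsLocalRing.ResidueField R
  let E := Ext (ModuleCat.of R k) (ModuleCat.of R R) 1
  let S : ShortComplex (ModuleCat.{u} R) := ShortComplex.mk
    (ModuleCat.ofHom (LinearMap.lsmul R R x))
    (ModuleCat.ofHom (Ideal.span {x}).mkQ) (by
      ext
      simp)
  have hS : S.ShortExact :=
    { exact := by
        rw [ShortComplex.moduleCat_exact_iff]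
        intro y hy
        obtain ⟨a, ha⟩ := Ideal.mem_span_singleton'.mp
          ((Submodule.Quotient.mk_eq_zero (Ideal.span {x})).mp hy)
        exact ⟨a, (mul_comm x a).trans ha⟩
      mono_f := by
        rw [ModuleCat.mono_iff_injective]
        exact fun a b hab => (mul_cancel_left_mem_nonZeroDivisors hx).mp hab
      epi_g := by
        rw [ModuleCat.epi_iff_surjective]
        exact Submodule.mkQ_surjective _ }
  let δ : (k →ₗ[R] R ⧸ Ideal.span {x}) →ₗ[R] E :=
    { toFun f := (Ext.mk₀ (ModuleCat.ofHom f : ModuleCat.of R k ⟶ S.X₃)).comp hS.extClass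
        (zero_add 1)
      map_add' f g := by
        rw [ModuleCat.ofHom_add, Ext.mk₀_add, Ext.add_comp]
      map_smul' r f := by
        have : (ModuleCat.ofHom (r • f) : ModuleCat.of R k ⟶ S.X₃) = r • ModuleCat.ofHom f := rfl
        rw [this, Ext.mk₀_smul, Ext.smul_comp, RingHom.id_apply] }
  have hδ : Function.Injective δ := by
    rw [← LinearMap.ker_eq_bot, LinearMap.ker_eq_bot']
    intro f hf
    obtain ⟨g, hg⟩ := Ext.covariant_sequence_exact₃ _ hS _ (zero_add 1) hf
    obtain ⟨g, rfl⟩ := (Ext.mk₀_bijective _ _).2 g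
    rw [Ext.mk₀_comp_mk₀] at hg
    have hg := (Ext.mk₀_bijective _ _).1 hg
    have hg0 : g.hom = 0 := by
      ext y
      have h1 : x • y = 0 := by
        obtain ⟨a, rfl⟩ := IsLocalRing.residue_surjective y
        rw [Algebra.smul_def, IsLocalRing.ResidueField.algebraMap_eq, ← map_mul]
        exact (IsLocalRing.residue_eq_zero_iff _).mpr (Ideal.mul_mem_right _ _ hxm)
      have h2 : x * g.hom y = 0 := by
        rw [← smul_eq_mul, ← map_smul, h1, map_zero]
      simpa using (mul_left_mem_nonZeroDivisors_eq_zero_iff hx).mp h2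
    ext y
    have := congr($(hg).hom y)
    simp only [ModuleCat.hom_comp, hg0] at this
    simpa using this.symm
  obtain ⟨-, e, -, he⟩ := hGor
  have he' : ∀ r ∈ IsLocalRing.maximalIdeal R, r • e = 0 := by
    intro r hr
    have : r • e = (Ext.mk₀ (r • 𝟙 (ModuleCat.of R k))).comp e (zero_add 1) := by
      rw [Ext.mk₀_smul, Ext.smul_comp, Ext.mk₀_id_comp]
    have h0 : r • 𝟙 (ModuleCat.of R k) = 0 := by
      ext y
      obtain ⟨a, rfl⟩ := IsLocalRing.residue_surjective y
      change r • IsLocalRing.residue R a = 0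
      rw [Algebra.smul_def, IsLocalRing.ResidueField.algebraMap_eq, ← map_mul]
      exact (IsLocalRing.residue_eq_zero_iff _).mpr (Ideal.mul_mem_right _ _ hr)
    rw [this, h0, Ext.mk₀_zero, Ext.zero_comp]
  let φ : R ⧸ IsLocalRing.maximalIdeal R →ₗ[R] E :=
    (IsLocalRing.maximalIdeal R).liftQ (LinearMap.toSpanSingleton R E e)
      fun r hr => he' r hr
  have hφ : Function.Surjective φ := fun e' => by
    obtain ⟨r, hr⟩ := he e'
    refine ⟨Submodule.Quotient.mk r, ?_⟩
    rw [hr, ← Ext.smul_eq_comp_mk₀]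
    rfl
  calc _ ≤ Module.length R E := Module.length_le_of_injective δ hδ
    _ ≤ Module.length R (R ⧸ IsLocalRing.maximalIdeal R) := Module.length_le_of_surjective φ hφ
    _ = 1 := by
      rw [Module.length_eq_one_iff, isSimpleModule_iff_isCoatom]
      exact (IsLocalRing.maximalIdeal.isMaximal R).out

lemma length_hom_le_length {R : Type*} [CommRing R] [IsLocalRing R] {A : Type*} [AddCommGroup A]
    [Module R A] (hA : Module.length R (IsLocalRing.ResidueField R →ₗ[R] A) ≤ 1)
    {W : Type*} [AddCommGroup W] [Module R W] (hW : IsFiniteLength R W) :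
    Module.length R (W →ₗ[R] A) ≤ Module.length R W := by
  induction hW with
  | of_subsingleton => simp
  | @of_simple_quotient W _ _ N hs _ ih =>
    have h1 : Module.length R (W ⧸ N →ₗ[R] A) ≤ 1 := by
      obtain ⟨I, hI, ⟨e⟩⟩ := isSimpleModule_iff_quot_maximal.mp hs
      obtain rfl := IsLocalRing.eq_maximalIdeal hI
      exact (LinearEquiv.length_eq (e.congrLeft A R)).trans_le hA
    let f : (W ⧸ N →ₗ[R] A) →ₗ[R] (W →ₗ[R] A) := LinearMap.lcomp R A N.mkQ
    let g : (W →ₗ[R] A) →ₗ[R] (N →ₗ[R] A) := LinearMap.lcomp R A N.subtype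
    have hf : Function.Injective f := fun a b hab => by
      ext y
      exact congr($hab y)
    have hfg : Function.Exact f g.rangeRestrict := by
      rw [LinearMap.exact_iff, LinearMap.ker_rangeRestrict]
      refine le_antisymm (fun a ha => ?_) ?_
      · refine ⟨N.liftQ a fun y hy => congr($(LinearMap.mem_ker.mp ha) ⟨y, hy⟩), ?_⟩
        ext y
        rfl
      · rintro _ ⟨a, rfl⟩
        ext y
        simp [f, g, (Submodule.Quotient.mk_eq_zero N).mpr y.2]
    have h2 : Module.length R W = Module.length R N + Module.length R (W ⧸ N) :=
      Module.length_eq_add_of_exact N.subtype N.mkQ N.subtype_injective N.mkQ_surjective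
        (LinearMap.exact_subtype_mkQ N)
    rw [h2, Module.length_eq_add_of_exact f g.rangeRestrict hf g.surjective_rangeRestrict hfg,
      Module.length_eq_one R (W ⧸ N), add_comm]
    exact add_le_add ((Module.length_le_of_injective g.range.subtype
      g.range.subtype_injective).trans ih) h1

/-- An `R`-module `A` such that `Hom(k, A)` has length at most one separates points of `F`
from submodules, as soon as `Hom(F, A)` is at least as long as `F`. -/
lemma exists_hom_ne_zero_of_notMem {R : Type*} [CommRing R] [IsLocalRing R] {A : Type*}
    [AddCommGroup A] [Module R A]
    (hA : Module.length R (IsLocalRing.ResidueField R →ₗ[R] A) ≤ 1)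
    {F : Type*} [AddCommGroup F] [Module R F] (hF : IsFiniteLength R F)
    (hF' : Module.length R F ≤ Module.length R (F →ₗ[R] A)) (N : Submodule R F) {v : F}
    (hv : v ∉ N) : ∃ f : F →ₗ[R] A, (∀ y ∈ N, f y = 0) ∧ f v ≠ 0 := by
  by_contra! H
  let N' := N ⊔ Submodule.span R {v}
  let g : (F →ₗ[R] A) →ₗ[R] (N →ₗ[R] A) := LinearMap.lcomp R A N.subtype
  have hker : ∀ f ∈ g.ker, N' ≤ f.ker := fun f hf => by
    have hfN : ∀ y ∈ N, f y = 0 := fun y hy => congr($(LinearMap.mem_ker.mp hf) ⟨y, hy⟩)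
    exact sup_le hfN ((Submodule.span_singleton_le_iff_mem _ _).mpr (H f hfN))
  let j : g.ker →ₗ[R] (F ⧸ N' →ₗ[R] A) :=
    { toFun f := N'.liftQ f.1 (hker f.1 f.2)
      map_add' a b := by ext; rfl
      map_smul' r a := by ext; rfl }
  have hj : Function.Injective j := fun a b hab => by
    ext y
    exact congr($hab (N'.mkQ y))
  have : IsNoetherian R F := (isFiniteLength_iff_isNoetherian_isArtinian.mp hF).1
  have : IsArtinian R F := (isFiniteLength_iff_isNoetherian_isArtinian.mp hF).2
  have hsub (P : Submodule R F) : IsFiniteLength R P := hF.of_injective P.subtype_injective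
  have hquot (P : Submodule R F) : IsFiniteLength R (F ⧸ P) := hF.of_surjective P.mkQ_surjective
  have hadd (P : Submodule R F) :
      Module.length R F = Module.length R P + Module.length R (F ⧸ P) :=
    Module.length_eq_add_of_exact P.subtype P.mkQ P.subtype_injective P.mkQ_surjective
      (LinearMap.exact_subtype_mkQ P)
  have hlt : Module.length R N < Module.length R N' := by
    rw [Module.length_submodule, Module.length_submodule]
    refine Submodule.height_strictMono (lt_of_le_of_ne le_sup_left fun h => hv ?_)
    rw [h]
    exact Submodule.mem_sup_right (Submodule.mem_span_singleton_self v)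
  have h1 : Module.length R F ≤ Module.length R N + Module.length R (F ⧸ N') := by
    refine hF'.trans ?_
    rw [Module.length_eq_add_of_exact g.ker.subtype g.rangeRestrict g.ker.subtype_injective
      g.surjective_rangeRestrict (by
        rw [LinearMap.exact_iff, LinearMap.ker_rangeRestrict, Submodule.range_subtype]), add_comm]
    exact add_le_add
      ((Module.length_le_of_injective g.range.subtype g.range.subtype_injective).trans
        (length_hom_le_length hA (hsub N)))
      ((Module.length_le_of_injective j hj).trans (length_hom_le_length hA (hquot N')))
  rw [hadd N'] at h1
  exact absurd h1 (not_le.mpr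
    ((ENat.add_lt_add_iff_right (Module.length_ne_top_iff.mpr (hquot N'))).mpr hlt))

/-- Over a one-dimensional Gorenstein ring, linear forms on `R ^ n` modulo `x` detect
membership in submodules containing `x R ^ n`. -/
lemma exists_linearForm_of_notMem_sup {R : Type u} [CommRing R] [IsNoetherianRing R]
    [IsLocalRing R] [HasExt.{u} (ModuleCat.{u} R)] [Ring.KrullDimLE 1 R]
    (hGor : IsGorensteinOneDim R) {x : R} (hx : x ∈ nonZeroDivisors R)
    (hxm : x ∈ IsLocalRing.maximalIdeal R) {ι : Type} [Fintype ι] (N : Submodule R (ι → R))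
    {v : ι → R} (hv : ∀ y, v - x • y ∉ N) :
    ∃ c : (ι → R) →ₗ[R] R, (∀ y ∈ N, x ∣ c y) ∧ ¬ x ∣ c v := by
  classical
  let A := R ⧸ Ideal.span {x}
  have hA := length_hom_residueField_le_one hGor hx hxm
  have hAl : IsFiniteLength R A := isFiniteLength_quotient_span hx
  have hF : IsFiniteLength R (ι → A) := by
    rw [isFiniteLength_iff_isNoetherian_isArtinian] at hAl ⊢
    have := hAl.1
    have := hAl.2
    exact ⟨inferInstance, inferInstance⟩
  let q : (ι → R) →ₗ[R] (ι → A) := LinearMap.compLeft (Ideal.span {x}).mkQ ι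
  have hF' : Module.length R (ι → A) ≤ Module.length R ((ι → A) →ₗ[R] A) := by
    let s : (ι → A) →ₗ[R] ((ι → A) →ₗ[R] A) :=
      LinearMap.mk₂ R (fun a b => ∑ i, a i * b i)
        (fun a b c => by simp [add_mul, Finset.sum_add_distrib])
        (fun r a b => by simp [Finset.smul_sum])
        (fun a b c => by simp [mul_add, Finset.sum_add_distrib])
        (fun r a b => by simp [Finset.smul_sum])
    refine Module.length_le_of_injective s fun a b hab => ?_
    ext i
    simpa [s, Pi.single_apply] using congr($hab (Pi.single i 1))
  have hv' : q v ∉ N.map q := by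
    rintro ⟨w, hw, hwv⟩
    have h (i : ι) : ∃ a, a * x = v i - w i := by
      rw [← Ideal.mem_span_singleton', ← Ideal.Quotient.eq]
      exact congr($hwv.symm i)
    choose y hy using h
    have : v - x • y = w := by
      ext i
      simp [mul_comm x, hy]
    exact hv y (this ▸ hw)
  obtain ⟨f, hf, hfv⟩ := exists_hom_ne_zero_of_notMem hA hF hF' (N.map q) hv'
  have hb (i : ι) : ∃ b : R, (Ideal.span {x}).mkQ b = f (q (Pi.single i 1)) :=
    Submodule.mkQ_surjective _ _
  choose b hb using hb
  let c : (ι → R) →ₗ[R] R := Fintype.linearCombination R b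
  have hc : (Ideal.span {x}).mkQ ∘ₗ c = f ∘ₗ q := by
    ext i
    simp [c, hb]
  have hdvd (y : ι → R) : x ∣ c y ↔ f (q y) = 0 := by
    rw [← Ideal.mem_span_singleton, ← Submodule.Quotient.mk_eq_zero]
    exact (congr($hc y = 0)).to_iff
  exact ⟨c, fun y hy => (hdvd y).mpr (hf _ ⟨y, hy, rfl⟩), fun h => hfv ((hdvd v).mp h)⟩

/-- A linear form on `R ^ n` detects membership in submodules of `R ^ n` modulo a power
of `x`. -/
lemma exists_linearForm_of_notMem {R : Type u} [CommRing R] [IsNoetherianRing R]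
    [IsLocalRing R] [HasExt.{u} (ModuleCat.{u} R)] [Ring.KrullDimLE 1 R]
    (hGor : IsGorensteinOneDim R) {x : R} (hx : x ∈ nonZeroDivisors R)
    (hxm : x ∈ IsLocalRing.maximalIdeal R) {ι : Type} [Fintype ι] (N : Submodule R (ι → R))
    {v : ι → R} (hv : v ∉ N) :
    ∃ (k : ℕ) (c : (ι → R) →ₗ[R] R), (∀ y ∈ N, x ^ (k + 1) ∣ c y) ∧ ¬ x ^ (k + 1) ∣ c v := by
  have hk : ∃ k : ℕ, ∀ y, v - x ^ (k + 1) • y ∉ N := by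
    by_contra! H
    refine hv ((Submodule.Quotient.mk_eq_zero N).mp ?_)
    have h := Ideal.iInf_pow_smul_eq_bot_of_isLocalRing (M := (ι → R) ⧸ N)
      (IsLocalRing.maximalIdeal R) (IsLocalRing.maximalIdeal.isMaximal R).ne_top
    rw [← Submodule.mem_bot R, ← h, Submodule.mem_iInf]
    intro i
    obtain ⟨y, hy⟩ := H i
    have : N.mkQ v = x ^ (i + 1) • N.mkQ y := by
      rw [← map_smul, ← sub_eq_zero, ← map_sub]
      exact (Submodule.Quotient.mk_eq_zero N).mpr hy
    change N.mkQ v ∈ _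
    rw [this]
    exact Submodule.smul_mem_smul (Ideal.pow_le_pow_right i.le_succ (Ideal.pow_mem_pow hxm _))
      trivial
  obtain ⟨k, hk⟩ := hk
  exact ⟨k, exists_linearForm_of_notMem_sup hGor (pow_mem hx _)
    (Ideal.pow_mem_of_mem _ hxm _ k.succ_pos) N hk⟩

end Gorenstein

section FreeFactorization

open TensorProduct

variable {R : Type*} [CommRing R] {M : Type*} [AddCommGroup M] [Module R M]

lemma exists_factorization_of_mem_range_dualTensorHom {φ : Module.End R M}
    (hφ : φ ∈ LinearMap.range (dualTensorHom R M M)) :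
    ∃ (n : ℕ) (a : M →ₗ[R] (Fin n → R)) (b : (Fin n → R) →ₗ[R] M), φ = b ∘ₗ a := by
  obtain ⟨t, rfl⟩ := hφ
  obtain ⟨n, β, w, rfl⟩ := TensorProduct.exists_sum_tmul_eq t
  refine ⟨n, LinearMap.pi β, Fintype.linearCombination R w, ?_⟩
  ext v
  simp [Fintype.linearCombination_apply]

variable [IsNoetherianRing R] [Module.Finite R M]

lemma exists_smul_id_mem_range_dualTensorHom_of_free (q : Ideal R) [q.IsPrime]
    [Module.Free (Localization.AtPrime q) (LocalizedModule q.primeCompl M)] :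
    ∃ s ∉ q, s • (LinearMap.id : Module.End R M) ∈ LinearMap.range (dualTensorHom R M M) := by
  have := Module.finitePresentation_of_finite R M
  let S := q.primeCompl
  let Rq := Localization.AtPrime q
  let Mq := LocalizedModule S M
  let f : M →ₗ[R] Mq := LocalizedModule.mkLinearMap S M
  let g : R →ₗ[R] Rq := Algebra.linearMap R Rq
  let ι := Module.Free.ChooseBasisIndex Rq Mq
  let e : Module.Basis ι Rq Mq := Module.Free.chooseBasis Rq Mq
  let c (i : ι) : Mq →ₗ[R] Rq := (e.coord i).restrictScalars R
  obtain ⟨s, hs⟩ := IsLocalizedModule.exist_integer_multiples_of_finite S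
    (IsLocalizedModule.map S f g) c
  obtain ⟨t, ht⟩ := IsLocalizedModule.exist_integer_multiples_of_finite S f e
  choose α hα using hs
  choose u hu using ht
  let φ : M →ₗ[R] M := dualTensorHom R M M (∑ i, α i ⊗ₜ u i)
  have hφ : IsLocalizedModule.map S f f φ =
      IsLocalizedModule.map S f f ((s.1 * t.1) • LinearMap.id) := by
    refine IsLocalizedModule.linearMap_ext S f f ?_
    rw [IsLocalizedModule.map_comp, IsLocalizedModule.map_comp]
    ext v
    have h1 (i : ι) : g (α i v) = s.1 • e.repr (f v) i := by
      rw [← IsLocalizedModule.map_apply S f g (α i) v, hα i]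
      rfl
    have h2 (i : ι) : f (α i v • u i) = (s.1 * t.1) • (e.repr (f v) i • e i) := by
      have : α i v • f (u i) = g (α i v) • f (u i) := (algebraMap_smul Rq _ _).symm
      rw [map_smul, this, h1, hu, mul_smul, smul_assoc, smul_comm t.1]
    simp only [LinearMap.comp_apply, φ, map_sum, LinearMap.sum_apply, dualTensorHom_apply, h2,
      LinearMap.smul_apply, LinearMap.id_apply, map_smul, ← Finset.smul_sum, e.sum_repr]
  obtain ⟨r, hr⟩ := IsLocalizedModule.exists_of_eq (S := S) hφ
  refine ⟨r.1 * (s.1 * t.1), (r * (s * t)).2, ?_⟩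
  have h3 : r.1 • ((s.1 * t.1) • (LinearMap.id : Module.End R M)) = r.1 • φ := hr.symm
  rw [mul_smul, h3]
  exact Submodule.smul_mem _ _ ⟨_, rfl⟩

lemma exists_pow_smul_id_mem_range_dualTensorHom [IsLocalRing R]
    (hloc : ∀ (q : Ideal R) (_ : q.IsPrime), q ≠ IsLocalRing.maximalIdeal R →
      Module.Free (Localization.AtPrime q) (LocalizedModule q.primeCompl M))
    {x : R} (hx : x ∈ IsLocalRing.maximalIdeal R) :
    ∃ k : ℕ, x ^ k • (LinearMap.id : Module.End R M) ∈ LinearMap.range (dualTensorHom R M M) := by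
  let J : Ideal R := (LinearMap.range (dualTensorHom R M M)).comap
    (LinearMap.toSpanSingleton R (Module.End R M) LinearMap.id)
  have hJ : x ∈ J.radical := by
    rw [Ideal.radical_eq_sInf, Submodule.mem_sInf]
    rintro q ⟨hJq, hq⟩
    by_cases h : q = IsLocalRing.maximalIdeal R
    · rwa [h]
    have := hloc q hq h
    obtain ⟨s, hs, hs'⟩ := exists_smul_id_mem_range_dualTensorHom_of_free (M := M) q
    exact absurd (hJq hs') hs
  exact hJ

end FreeFactorization

section Fitting

open TensorProduct Polynomial

lemma isAdicComplete_of_finite {R : Type*} [CommRing R] [IsNoetherianRing R] [IsLocalRing R]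
    [IsAdicComplete (IsLocalRing.maximalIdeal R) R] (M : Type*) [AddCommGroup M] [Module R M]
    [Module.Finite R M] : IsAdicComplete (IsLocalRing.maximalIdeal R) M where
  toIsPrecomplete := by
    rw [← AdicCompletion.of_surjective_iff]
    intro y
    obtain ⟨t, rfl⟩ := AdicCompletion.ofTensorProduct_surjective_of_finite
      (IsLocalRing.maximalIdeal R) M y
    induction t with
    | zero => exact ⟨0, by simp⟩
    | add t s ht hs =>
      obtain ⟨a, ha⟩ := ht
      obtain ⟨b, hb⟩ := hs
      exact ⟨a + b, by rw [map_add, map_add, ha, hb]⟩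
    | tmul r v =>
      obtain ⟨r, rfl⟩ := AdicCompletion.of_surjective (IsLocalRing.maximalIdeal R) R r
      refine ⟨r • v, ?_⟩
      rw [AdicCompletion.ofTensorProduct_tmul, map_smul]
      rfl

lemma exists_isIdempotentElem_sub_mem {S : Type*} [CommRing S] (I : Ideal S)
    [IsAdicComplete I S] {e : S} (he : e * e - e ∈ I) :
    ∃ e' : S, IsIdempotentElem e' ∧ e' - e ∈ I := by
  have hm : (X ^ 2 - X : S[X]).Monic := by monicity!
  obtain ⟨e', h1, h2⟩ := HenselianRing.is_henselian (I := I) (X ^ 2 - X : S[X]) hm e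
    (by simpa [pow_two] using he) (by
      refine IsUnit.of_mul_eq_one (Ideal.Quotient.mk I (2 * e - 1)) ?_
      rw [← map_mul, ← map_one (Ideal.Quotient.mk I), Ideal.Quotient.eq]
      have : derivative (X ^ 2 - X : S[X]) = C 2 * X - 1 := by simp [one_add_one_eq_two]
      rw [this]
      simp only [eval_sub, eval_mul, eval_C, eval_X, eval_one]
      have : (2 * e - 1) * (2 * e - 1) - 1 = 4 * (e * e - e) := by ring
      rw [this]
      exact I.mul_mem_left _ he)
  refine ⟨e', ?_, h2⟩
  have : e' ^ 2 - e' = 0 := by simpa [IsRoot] using h1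
  rw [IsIdempotentElem, ← pow_two]
  exact sub_eq_zero.mp this

variable {R : Type*} [CommRing R] {M : Type*} [AddCommGroup M] [Module R M]

lemma IsIndecomposableModule.eq_zero_or_eq_one (hind : IsIndecomposableModule R M)
    {e : Module.End R M} (he : IsIdempotentElem e) : e = 0 ∨ e = 1 := by
  by_contra! h
  refine hind.2 ⟨LinearMap.range e, LinearMap.ker e, ?_, ?_, ?_⟩
  · exact LinearMap.IsIdempotentElem.isCompl he
  · rw [Ne, LinearMap.range_eq_bot]
    exact h.1
  · intro hk
    refine h.2 (LinearMap.ext fun v => ?_)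
    have : v - e v ∈ LinearMap.ker e := by
      rw [LinearMap.mem_ker, map_sub, ← Module.End.mul_apply, he.eq, sub_self]
    rw [hk, Submodule.mem_bot, sub_eq_zero] at this
    exact this.symm

lemma IsIndecomposableModule.not_bijective_comp (hind : IsIndecomposableModule R M)
    {h : Module.End R M} (hh : ¬ Function.Bijective h) (f : Module.End R M) :
    ¬ Function.Bijective (f * h : Module.End R M) := by
  intro hb
  obtain ⟨θ, hθ⟩ := (Module.End.isUnit_iff _).mpr hb
  have h1 : (↑θ⁻¹ : Module.End R M) * (f * h) = 1 := by rw [← hθ]; simp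
  have he : IsIdempotentElem (h * (↑θ⁻¹ * f) : Module.End R M) := by
    rw [IsIdempotentElem, mul_assoc, ← mul_assoc _ h, mul_assoc _ f h, h1, one_mul]
  rcases hind.eq_zero_or_eq_one he with h0 | h0
  · have := hind.1
    have h2 : (1 : Module.End R M) = 0 := by
      rw [← mul_one (1 : Module.End R M), ← h1]
      calc _ = (↑θ⁻¹ * f) * (h * (↑θ⁻¹ * f)) * h := by
            simp only [mul_assoc, h1, mul_one]
        _ = 0 := by rw [h0]; simp
    exact one_ne_zero h2
  · refine hh ((Module.End.isUnit_iff _).mp ⟨⟨h, ↑θ⁻¹ * f, h0, ?_⟩, rfl⟩)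
    rw [mul_assoc, h1]

lemma exists_isIdempotentElem_of_finite [IsNoetherianRing R] [IsLocalRing R]
    [IsAdicComplete (IsLocalRing.maximalIdeal R) R] {S : Type*} [CommRing S] [Algebra R S]
    [Module.Finite R S] (s : S) :
    ∃ (n : ℕ) (e y : S), IsIdempotentElem e ∧
      s ^ (n + 1) - s ^ (n + 1) * e ∈ (IsLocalRing.maximalIdeal R).map (algebraMap R S) ∧
      e - s ^ (n + 1) * y ∈ (IsLocalRing.maximalIdeal R).map (algebraMap R S) := by
  let m := IsLocalRing.maximalIdeal R
  let I : Ideal S := m.map (algebraMap R S)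
  have hc : IsAdicComplete I S :=
    (IsAdicComplete.map_algebraMap_iff _ _).mpr (isAdicComplete_of_finite S)
  have hfin' : Module.Finite (R ⧸ m) (S ⧸ I) := Module.Finite.of_restrictScalars_finite R _ _
  have hart : IsArtinianRing (S ⧸ I) := by
    let := Ideal.Quotient.field m
    exact IsArtinianRing.of_finite (R ⧸ m) _
  obtain ⟨n, y, hy⟩ := IsArtinian.exists_pow_succ_smul_dvd (Ideal.Quotient.mk I s) (1 : S ⧸ I)
  obtain ⟨y, rfl⟩ := Ideal.Quotient.mk_surjective y
  set s' := Ideal.Quotient.mk I s with hs'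
  set y' := Ideal.Quotient.mk I y with hy'
  have hy0 : s' ^ (n + 1) * y' = s' ^ n := by simpa using hy
  have hy1 : s' ^ (n + 1) * (s' * y') = s' ^ (n + 1) := by
    calc _ = s' * (s' ^ (n + 1) * y') := by ring
      _ = _ := by rw [hy0, pow_succ']
  have hy2 (k : ℕ) : s' ^ (n + 1) * (s' * y') ^ k = s' ^ (n + 1) := by
    induction k with
    | zero => simp
    | succ k ih => rw [pow_succ (s' * y'), ← mul_assoc, ih, hy1]
  have hy3 : s' ^ (n + 1) * (s' ^ (n + 1) * y' ^ (n + 1)) = s' ^ (n + 1) := by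
    rw [← mul_pow, hy2]
  obtain ⟨e, he, hee⟩ := exists_isIdempotentElem_sub_mem I
    (e := s ^ (n + 1) * y ^ (n + 1)) (by
      rw [← Ideal.Quotient.eq]
      simp only [map_mul, map_pow, ← hs', ← hy']
      calc _ = s' ^ (n + 1) * (s' ^ (n + 1) * y' ^ (n + 1)) * y' ^ (n + 1) := by ring
        _ = _ := by rw [hy3])
  refine ⟨n, e, y ^ (n + 1), he, ?_, hee⟩
  rw [← Ideal.Quotient.eq, map_mul, Ideal.Quotient.eq.mpr hee]
  simp only [map_mul, map_pow, ← hs', ← hy']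
  exact hy3.symm

lemma exists_finite_algebra_of_end {R : Type u} [CommRing R] [IsNoetherianRing R] {M : Type*}
    [AddCommGroup M] [Module R M] [Module.Finite R M] (φ : Module.End R M) :
    ∃ (S : Type u) (_ : CommRing S) (_ : Algebra R S) (_ : Module.Finite R S)
      (Φ : S →ₐ[R] Module.End R M) (s : S), Φ s = φ := by
  obtain ⟨f, hf, hφ⟩ := LinearMap.exists_monic_and_aeval_eq_zero R φ
  refine ⟨AdjoinRoot f, inferInstance, inferInstance, hf.finite_adjoinRoot,
    Ideal.Quotient.liftₐ (Ideal.span {f}) (aeval φ) fun a ha => ?_, AdjoinRoot.root f, ?_⟩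
  · obtain ⟨b, rfl⟩ := Ideal.mem_span_singleton'.mp ha
    rw [map_mul, hφ, mul_zero]
  · exact aeval_X φ

lemma IsIndecomposableModule.exists_range_pow_le [IsNoetherianRing R] [IsLocalRing R]
    [IsAdicComplete (IsLocalRing.maximalIdeal R) R] [Module.Finite R M]
    (hind : IsIndecomposableModule R M) {φ : Module.End R M} (hφ : ¬ Function.Bijective φ) :
    ∃ n : ℕ, LinearMap.range (φ ^ n) ≤
      IsLocalRing.maximalIdeal R • (⊤ : Submodule R M) := by
  let m := IsLocalRing.maximalIdeal R
  obtain ⟨S, _, _, _, Φ, s, hs⟩ := exists_finite_algebra_of_end φ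
  have hΦI (i : S) (hi : i ∈ m.map (algebraMap R S)) (v : M) :
      Φ i v ∈ m • (⊤ : Submodule R M) := by
    induction hi using Submodule.span_induction generalizing v with
    | mem i hi =>
      obtain ⟨r, hr, rfl⟩ := hi
      rw [AlgHom.commutes, Module.algebraMap_end_apply]
      exact Submodule.smul_mem_smul hr trivial
    | zero => simp
    | add i j _ _ h1 h2 => rw [map_add]; exact add_mem (h1 v) (h2 v)
    | smul t i _ h1 => rw [smul_eq_mul, mul_comm, map_mul]; exact h1 _
  obtain ⟨n, e, y, he, hse, hey⟩ := exists_isIdempotentElem_of_finite (R := R) s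
  refine ⟨n + 1, ?_⟩
  rcases hind.eq_zero_or_eq_one (he.map Φ) with h0 | h0
  · rintro _ ⟨v, rfl⟩
    have := hΦI _ hse v
    rwa [map_sub, map_mul, h0, mul_zero, sub_zero, map_pow, hs] at this
  · exfalso
    have hsurj : Function.Surjective (φ ^ (n + 1) : Module.End R M) := by
      rw [← LinearMap.range_eq_top]
      refine top_le_iff.mp (Submodule.le_of_le_smul_of_le_jacobson_bot (I := m)
        Module.Finite.fg_top (IsLocalRing.maximalIdeal_le_jacobson _) fun v _ => ?_)
      have h1 := hΦI _ hey v
      rw [map_sub, h0, LinearMap.sub_apply, Module.End.one_apply, map_mul, map_pow, hs,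
        Module.End.mul_apply] at h1
      rw [← sub_add_cancel v ((φ ^ (n + 1)) (Φ y v)), add_comm (_ - _)]
      exact Submodule.add_mem_sup ⟨_, rfl⟩ h1
    have hsurj' : Function.Surjective φ := by
      rw [pow_succ'] at hsurj
      exact Function.Surjective.of_comp (g := (φ ^ n : Module.End R M)) hsurj
    exact hφ ⟨IsNoetherian.injective_of_surjective_endomorphism φ hsurj', hsurj'⟩

end Fitting

section NoFreeSummand

variable {R : Type*} [CommRing R] [IsLocalRing R] {M : Type*} [AddCommGroup M] [Module R M]

lemma IsIndecomposableModule.apply_mem_maximalIdeal (hind : IsIndecomposableModule R M)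
    (hfree : ¬ Module.Free R M) (y : M →ₗ[R] R) (v : M) :
    y v ∈ IsLocalRing.maximalIdeal R := by
  by_contra hv
  obtain ⟨r, hr⟩ := IsLocalRing.notMem_maximalIdeal.mp hv
  let w : M := (↑r⁻¹ : R) • v
  have hw : y w = 1 := by simp [w, ← hr]
  let e : Module.End R M := y.smulRight w
  have he : IsIdempotentElem e := by
    ext u
    simp [e, hw]
  rcases hind.eq_zero_or_eq_one he with h0 | h0
  · have : y (e w) = 0 := by rw [h0]; simp
    simp [e, hw] at this
  · refine hfree (Module.Free.of_equiv (LinearEquiv.ofLinearMap (LinearMap.toSpanSingleton R M w) y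
      ?_ ?_))
    · exact h0
    · ext
      simp [hw]

end NoFreeSummand

section Fraction

open TensorProduct

variable {R : Type*} [CommRing R] {Q : Type*} [CommRing Q] [Algebra R Q]
  [IsLocalization (nonZeroDivisors R) Q]

lemma baseChange_eq_smul_id_iff {M : Type*} [AddCommGroup M] [Module R M]
    (hM : ∀ b ∈ nonZeroDivisors R, IsSMulRegular M b) {γ : Q} {a b : R}
    (hb : b ∈ nonZeroDivisors R) (hab : algebraMap R Q b * γ = algebraMap R Q a)
    (g : Module.End R M) :
    LinearMap.baseChange Q (g : M →ₗ[R] M) = γ • (LinearMap.id : Q ⊗[R] M →ₗ[Q] Q ⊗[R] M) ↔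
      b • g = a • (LinearMap.id : Module.End R M) := by
  have hinj : Function.Injective (TensorProduct.mk R Q M 1) := by
    intro v w hvw
    obtain ⟨c, hc⟩ := IsLocalizedModule.exists_of_eq (S := nonZeroDivisors R) hvw
    exact hM c.1 c.2 hc
  have hunit : IsUnit (algebraMap R Q b) := IsLocalization.map_units Q ⟨b, hb⟩
  have key (v : M) : (1 : Q) ⊗ₜ[R] g v = γ • ((1 : Q) ⊗ₜ[R] v) ↔ b • g v = a • v := by
    rw [← hinj.eq_iff, ← hunit.smul_left_cancel, smul_smul, hab]
    simp [algebraMap_smul]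
  constructor
  · intro h
    ext v
    exact (key v).mp (by simpa using LinearMap.congr_fun h ((1 : Q) ⊗ₜ[R] v))
  · intro h
    ext v
    have := (key v).mpr (LinearMap.congr_fun h v)
    simpa using this

lemma mul_dvd_mul_of_isIntegral {p : Ideal R} {Q' : Type*} [Field Q'] [Algebra (R ⧸ p) Q']
    [FaithfulSMul (R ⧸ p) Q'] [Algebra R Q'] [IsScalarTower R (R ⧸ p) Q'] {π : Q →ₐ[R] Q'}
    {γt : Q}
    (h1 : ∀ x : integralClosure (R ⧸ p) Q', ¬IsUnit x →
      π γt * (x : Q') ∈ (algebraMap (R ⧸ p) Q').range)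
    {z : R} (hz : ∀ r : R, r * z = 0 ↔ r ∈ p) {a b : R}
    (hab : algebraMap R Q b * (algebraMap R Q z * γt) = algebraMap R Q a)
    {t d : R} {τ : integralClosure (R ⧸ p) Q'} (hτ : ¬ IsUnit τ)
    (htd : algebraMap R Q' d * (τ : Q') = algebraMap R Q' t) : b * d ∣ a * t := by
  obtain ⟨s, hs⟩ := h1 τ hτ
  obtain ⟨s, rfl⟩ := Ideal.Quotient.mk_surjective s
  have hs' : π γt * (τ : Q') = algebraMap R Q' s := by
    rw [← hs, IsScalarTower.algebraMap_apply R (R ⧸ p) Q']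
    rfl
  have hker (q : Q) (hq : π q = 0) : algebraMap R Q z * q = 0 := by
    obtain ⟨⟨r, c⟩, hrc⟩ := IsLocalization.surj (nonZeroDivisors R) q
    have h2 : algebraMap R Q' r = 0 := by
      rw [← π.commutes, ← hrc, map_mul, hq, zero_mul]
    rw [IsScalarTower.algebraMap_apply R (R ⧸ p) Q', FaithfulSMul.algebraMap_eq_zero_iff] at h2
    have h3 : r * z = 0 := (hz r).mpr (Ideal.Quotient.eq_zero_iff_mem.mp h2)
    refine (IsLocalization.map_units Q c).mul_left_injective ?_
    change algebraMap R Q z * q * _ = 0 * _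
    rw [mul_assoc, hrc, ← map_mul, mul_comm, h3, map_zero, zero_mul]
  have h4 := hker (γt * algebraMap R Q t - algebraMap R Q (d * s)) (by
    rw [map_sub, map_mul, π.commutes, π.commutes, ← htd, map_mul, ← hs']
    ring)
  refine ⟨z * s, IsLocalization.injective Q (le_refl (nonZeroDivisors R)) ?_⟩
  simp only [map_mul, ← hab] at h4 ⊢
  linear_combination algebraMap R Q b * h4

end Fraction

section Trace

open Polynomial

lemma mem_of_weaklyEisenstein {A : Type*} [CommRing A] [IsLocalRing A] {B : Type*} [CommRing B]
    [Algebra A B] [Algebra.IsIntegral A B] (n : Ideal B) [n.IsMaximal] {f : A[X]} (hf : f.Monic)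
    (hfm : f.IsWeaklyEisensteinAt (IsLocalRing.maximalIdeal A)) {x : B} (hx : aeval x f = 0) :
    x ∈ n := by
  have h := hfm.pow_natDegree_le_of_aeval_zero_of_monic_mem_map hx hf _ le_rfl
  refine Ideal.IsPrime.mem_of_pow_mem inferInstance _ (Ideal.map_le_iff_le_comap.mpr ?_ h)
  have := Ideal.isMaximal_comap_of_isIntegral_of_isMaximal (R := A) n
  exact (IsLocalRing.eq_maximalIdeal this).ge

lemma eq_zero_or_aeval_pow_eq_zero {F : Type*} [Field F] {ι : Type*} [Fintype ι] [DecidableEq ι]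
    {Y : Matrix ι ι F} {f : F[X]} {N : ℕ} (h : Y * aeval (Y ^ N) f = 0) {x : F}
    (hx : x ∈ Y.charpoly.roots) : x = 0 ∨ eval (x ^ N) f = 0 := by
  have h1 := Matrix.mem_spectrum_of_isRoot_charpoly (isRoot_of_mem_roots hx)
  have h2 := spectrum.subset_polynomial_aeval Y (X * f.comp (X ^ N)) ⟨x, h1, rfl⟩
  have h3 : aeval Y (X * f.comp (X ^ N)) = 0 := by
    rw [map_mul, aeval_X, aeval_comp, aeval_X_pow, h]
  have : Nontrivial (Matrix ι ι F) := by
    by_contra hn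
    rw [not_nontrivial_iff_subsingleton] at hn
    exact h1 (isUnit_of_subsingleton _)
  rw [h3, spectrum.zero_eq] at h2
  simpa using h2

lemma exists_integralClosure_eq_trace {A : Type*} [CommRing A] [IsLocalRing A] {F : Type*}
    [Field F] [Algebra A F] {ι : Type*} [Fintype ι] [DecidableEq ι] {Y : Matrix ι ι F} {f : A[X]}
    (hf : f.Monic) (hfm : f.IsWeaklyEisensteinAt (IsLocalRing.maximalIdeal A)) {N : ℕ}
    (hN : 0 < N) (h : Y * aeval (Y ^ N) f = 0) :
    ∃ τ : integralClosure A F, ¬ IsUnit τ ∧ (τ : F) = Y.trace := by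
  let K := AlgebraicClosure F
  let B := integralClosure A K
  let φ : F →ₐ[A] K := IsScalarTower.toAlgHom A F K
  obtain ⟨n, hn⟩ := Ideal.exists_maximal B
  let Z : Matrix ι ι K := φ.mapMatrix Y
  have hZ : Z * aeval (Z ^ N) (f.map (algebraMap A K)) = 0 := by
    rw [aeval_map_algebraMap, ← map_pow, aeval_algHom_apply, ← map_mul, h, map_zero]
  have hroot (x : K) (hx : x ∈ Z.charpoly.roots) : ∃ y ∈ n, (y : K) = x := by
    rcases eq_zero_or_aeval_pow_eq_zero hZ hx with rfl | h0
    · exact ⟨0, n.zero_mem, rfl⟩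
    rw [eval_map_algebraMap] at h0
    have hxi : IsIntegral A x := IsIntegral.of_pow hN ⟨f, hf, h0⟩
    refine ⟨⟨x, hxi⟩, Ideal.IsPrime.mem_of_pow_mem inferInstance N
      (mem_of_weaklyEisenstein n hf hfm ?_), rfl⟩
    apply Subtype.val_injective
    change B.val (aeval ((⟨x, hxi⟩ : B) ^ N) f) = 0
    rw [← aeval_algHom_apply, map_pow]
    exact h0
  have htr : ∃ y ∈ n, (y : K) = φ Y.trace := by
    have h1 : φ Y.trace = Z.charpoly.roots.sum := by
      rw [← Matrix.trace_eq_sum_roots_charpoly]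
      exact AddMonoidHom.map_trace (φ : F →+ K) Y
    rw [h1]
    refine Multiset.sum_induction (fun x : K => ∃ y ∈ n, (y : K) = x) _ ?_ ?_ hroot
    · rintro _ _ ⟨y, hy, rfl⟩ ⟨y', hy', rfl⟩
      exact ⟨y + y', n.add_mem hy hy', rfl⟩
    · exact ⟨0, n.zero_mem, rfl⟩
  obtain ⟨y, hy, hy'⟩ := htr
  have hxi : IsIntegral A Y.trace := by
    have := y.2
    rw [hy'] at this
    exact (isIntegral_algHom_iff φ φ.injective).mp this
  refine ⟨⟨Y.trace, hxi⟩, fun hu => hn.ne_top (Ideal.eq_top_of_isUnit_mem n hy ?_), rfl⟩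
  convert! hu.map φ.mapIntegralClosure
  exact Subtype.ext hy'

lemma map_mul_aeval {R A B : Type*} [CommRing R] [Ring A] [Algebra R A] [Ring B] [Algebra R B]
    (Ψ : A →ₙₐ[R] B) (a : A) (f : R[X]) : Ψ (a * aeval a f) = Ψ a * aeval (Ψ a) f := by
  induction f using Polynomial.induction_on' with
  | add f g hf hg => simp [mul_add, hf, hg]
  | monomial n r =>
    have hpow : Ψ (a * a ^ n) = Ψ a * Ψ a ^ n := by
      induction n with
      | zero => simp
      | succ n ih => rw [pow_succ, ← mul_assoc, map_mul, ih, pow_succ, mul_assoc]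
    rw [aeval_monomial, aeval_monomial, ← Algebra.smul_def, ← Algebra.smul_def, mul_smul_comm,
      mul_smul_comm, map_smul, hpow]

end Trace

section Reflexive

lemma exists_smul_eq_of_forall_exists {R M N : Type*} [CommRing R] [AddCommGroup M] [Module R M]
    [AddCommGroup N] [Module R N] {s : R} (hs : IsSMulRegular N s) (f : M →ₗ[R] N)
    (h : ∀ v, ∃ w, s • w = f v) : ∃ y : M →ₗ[R] N, s • y = f := by
  choose y hy using h
  refine ⟨{ toFun := y, map_add' := fun v w => hs ?_, map_smul' := fun r v => hs ?_ }, ?_⟩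
  · simp only [smul_add, hy, map_add]
  · simp only [hy, map_smul, RingHom.id_apply, smul_comm s r]
  · ext v
    exact hy v

lemma exists_trace_eq {R : Type*} [CommRing R] {n : ℕ} (c : (Fin n × Fin n → R) →ₗ[R] R) :
    ∃ C : Module.End R (Fin n → R), ∀ X : Module.End R (Fin n → R),
      c (fun i => X (Pi.single i.2 1) i.1) = LinearMap.trace R _ (C * X) := by
  refine ⟨Matrix.toLin' (Matrix.of fun j i => c (Pi.single (i, j) 1)), fun X => ?_⟩
  obtain ⟨X, rfl⟩ := Matrix.toLin'.surjective X
  rw [Module.End.mul_eq_comp, ← Matrix.toLin'_mul, Matrix.trace_toLin'_eq,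
    LinearMap.pi_apply_eq_sum_univ c, Fintype.sum_prod_type, Matrix.trace, Finset.sum_comm]
  refine Finset.sum_congr rfl fun j _ => ?_
  rw [Matrix.diag_apply, Matrix.mul_apply]
  refine Finset.sum_congr rfl fun i _ => ?_
  simp only [Matrix.of_apply, Matrix.toLin'_apply, Matrix.mulVec_single_one, Matrix.col_apply,
    smul_eq_mul, mul_comm (c _)]
  congr 2
  ext l
  simp [Pi.single_apply, eq_comm]

variable {R : Type u} [CommRing R] [IsNoetherianRing R] [IsLocalRing R]
  [CategoryTheory.HasExt.{u} (ModuleCat.{u} R)] [Ring.KrullDimLE 1 R]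

lemma exists_smul_eq_of_forall_dvd (hGor : IsGorensteinOneDim R) {x : R}
    (hx : x ∈ nonZeroDivisors R) (hxm : x ∈ IsLocalRing.maximalIdeal R) {M : Type*}
    [AddCommGroup M] [Module R M] {n : ℕ} {α : M →ₗ[R] (Fin n → R)}
    (hα : Function.Injective α) {b : R} (hb : b ∈ nonZeroDivisors R) {w : M}
    (hw : ∀ y : M →ₗ[R] R, b ∣ y w) : ∃ v, b • v = w := by
  by_contra hv
  have hN : α w ∉ (LinearMap.range (b • (LinearMap.id : M →ₗ[R] M))).map α := by
    rintro ⟨_, ⟨v, rfl⟩, h⟩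
    exact hv ⟨v, hα h⟩
  obtain ⟨k, c, hc, hcw⟩ := exists_linearForm_of_notMem hGor hx hxm _ hN
  have hxk : x ^ (k + 1) ∈ nonZeroDivisors R := pow_mem hx _
  obtain ⟨y, hy⟩ := exists_smul_eq_of_forall_exists (s := x ^ (k + 1))
    (fun _ _ => (mul_cancel_left_mem_nonZeroDivisors hxk).mp) (b • (c ∘ₗ α)) fun v => by
      obtain ⟨r, hr⟩ := hc (α (b • v)) ⟨_, ⟨v, rfl⟩, rfl⟩
      refine ⟨r, ?_⟩
      rw [smul_eq_mul, ← hr]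
      simp
  obtain ⟨s, hs⟩ := hw y
  refine hcw ⟨s, (mul_cancel_left_mem_nonZeroDivisors hb).mp ?_⟩
  have := LinearMap.congr_fun hy w
  simp only [LinearMap.smul_apply, LinearMap.comp_apply, smul_eq_mul, hs] at this
  rw [← this]
  ring

lemma mul_mem_range_dualTensorHom (hGor : IsGorensteinOneDim R) {x : R}
    (hx : x ∈ nonZeroDivisors R) (hxm : x ∈ IsLocalRing.maximalIdeal R) {M : Type*}
    [AddCommGroup M] [Module R M] (hM : ∀ b ∈ nonZeroDivisors R, IsSMulRegular M b) {n : ℕ}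
    {α : M →ₗ[R] (Fin n → R)} {u : (Fin n → R) →ₗ[R] M} {d : R} (hd : d ∈ nonZeroDivisors R)
    (hu : u ∘ₗ α = d • LinearMap.id) {a b : R} (hb : b ∈ nonZeroDivisors R)
    {g h : Module.End R M} (hg : b • g = a • (LinearMap.id : Module.End R M))
    (hT : ∀ e : Module.End R M, b * d ∣ a * LinearMap.trace R _ (α ∘ₗ (e * h) ∘ₗ u)) :
    h * g ∈ LinearMap.range (dualTensorHom R M M) := by
  have huα (v : M) : u (α v) = d • v := LinearMap.congr_fun hu v
  have hα : Function.Injective α := fun v w hvw => hM d hd (by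
    change d • v = d • w
    rw [← huα, ← huα, hvw])
  let ι : Module.End R M →ₗ[R] (Fin n × Fin n → R) :=
    { toFun φ i := α (φ (u (Pi.single i.2 1))) i.1
      map_add' φ ψ := by ext; simp
      map_smul' r φ := by ext; simp }
  have hι : Function.Injective ι := by
    intro φ ψ hφ
    have h1 : φ ∘ₗ u = ψ ∘ₗ u := LinearMap.pi_ext' fun j => LinearMap.ext_ring (hα (by
      ext i
      exact congrFun hφ (i, j)))
    ext v
    apply hM d hd
    have := LinearMap.congr_fun h1 (α v)
    simpa [huα] using this
  by_contra hP
  have hN : ι (h * g) ∉ (LinearMap.range (dualTensorHom R M M)).map ι := by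
    rintro ⟨φ, hφ, hφ'⟩
    exact hP (hι hφ' ▸ hφ)
  obtain ⟨k, c, hc, hcw⟩ := exists_linearForm_of_notMem hGor hx hxm _ hN
  obtain ⟨C, hC⟩ := exists_trace_eq c
  have hcι (φ : Module.End R M) : c (ι φ) = LinearMap.trace R _ (C * (α ∘ₗ φ ∘ₗ u)) :=
    hC (α ∘ₗ φ ∘ₗ u)
  have hxk : x ^ (k + 1) ∈ nonZeroDivisors R := pow_mem hx _
  obtain ⟨e, he⟩ := exists_smul_eq_of_forall_exists (s := x ^ (k + 1)) (hM _ hxk)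
    (u ∘ₗ C ∘ₗ α) fun w => by
      refine exists_smul_eq_of_forall_dvd hGor hx hxm hα hxk fun β => ?_
      have h1 := hc (ι (β.smulRight w)) ⟨_, ⟨β ⊗ₜ w, rfl⟩, by congr⟩
      rw [hcι] at h1
      have h2 : C * (α ∘ₗ β.smulRight w ∘ₗ u) = (β ∘ₗ u).smulRight (C (α w)) := by
        ext
        simp
      rwa [h2, LinearMap.trace_smulRight] at h1
  obtain ⟨s, hs⟩ := hT e
  have key : d * c (ι (h * g)) =
      x ^ (k + 1) * LinearMap.trace R _ (α ∘ₗ (e * (h * g)) ∘ₗ u) := by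
    rw [hcι, ← smul_eq_mul d, ← map_smul, ← smul_eq_mul (x ^ (k + 1)), ← map_smul]
    calc _ = LinearMap.trace R _ ((C * (α ∘ₗ (h * g) ∘ₗ u)) * (α ∘ₗ u)) := by
          congr 1
          ext
          simp [huα]
      _ = _ := by
          rw [LinearMap.trace_mul_comm]
          congr 1
          ext j i
          have := LinearMap.congr_fun he (h (g (u (Pi.single j 1))))
          simp only [LinearMap.smul_apply, LinearMap.comp_apply] at this
          simpa using (congrFun (congrArg α this) i).symm
  have key2 : b * LinearMap.trace R _ (α ∘ₗ (e * (h * g)) ∘ₗ u) =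
      a * LinearMap.trace R _ (α ∘ₗ (e * h) ∘ₗ u) := by
    rw [← smul_eq_mul b, ← map_smul, ← smul_eq_mul a, ← map_smul]
    congr 1
    ext j i
    have := LinearMap.congr_fun hg (u (Pi.single j 1))
    simp only [LinearMap.smul_apply, LinearMap.id_apply] at this
    simpa using congrFun (congrArg (fun v => α (e (h v))) this) i
  refine hcw ⟨s, (mul_cancel_left_mem_nonZeroDivisors (mul_mem hb hd)).mp ?_⟩
  rw [mul_assoc, key]
  linear_combination x ^ (k + 1) * key2 + x ^ (k + 1) * hs

end Reflexive

section Socle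

open Polynomial

variable {R : Type*} [CommRing R] [IsLocalRing R] {Q : Type*} [CommRing Q] [Algebra R Q]
  [IsLocalization (nonZeroDivisors R) Q] {p : Ideal R} [p.IsPrime] {Q' : Type*} [Field Q']
  [Algebra (R ⧸ p) Q'] [FaithfulSMul (R ⧸ p) Q'] [Algebra R Q'] [IsScalarTower R (R ⧸ p) Q']
  {π : Q →ₐ[R] Q'} {γt : Q}

lemma mul_dvd_mul_of_trace
    (h1 : ∀ x : integralClosure (R ⧸ p) Q', ¬IsUnit x →
      π γt * (x : Q') ∈ (algebraMap (R ⧸ p) Q').range)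
    {z : R} (hz : ∀ r : R, r * z = 0 ↔ r ∈ p) {a b : R}
    (hab : algebraMap R Q b * (algebraMap R Q z * γt) = algebraMap R Q a)
    {ι : Type*} [Fintype ι] [DecidableEq ι] {Y : Matrix ι ι Q'} {f : R[X]} (hf : f.Monic)
    (hfm : f.IsWeaklyEisensteinAt (IsLocalRing.maximalIdeal R)) {N : ℕ} (hN : 0 < N)
    (h : Y * aeval (Y ^ N) f = 0) {t d : R}
    (htd : algebraMap R Q' d * Y.trace = algebraMap R Q' t) : b * d ∣ a * t := by
  have : IsLocalRing (R ⧸ p) := .of_surjective' (Ideal.Quotient.mk p) Ideal.Quotient.mk_surjective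
  have hmap : (IsLocalRing.maximalIdeal R).map (algebraMap R (R ⧸ p)) ≤
      IsLocalRing.maximalIdeal (R ⧸ p) := by
    have := IsLocalHom.of_surjective (algebraMap R (R ⧸ p)) Ideal.Quotient.mk_surjective
    exact ((IsLocalRing.local_hom_TFAE _).out 0 2).mp this
  have hfm' : (f.map (algebraMap R (R ⧸ p))).IsWeaklyEisensteinAt
      (IsLocalRing.maximalIdeal (R ⧸ p)) := ⟨fun hn => hmap ((hfm.map _).mem hn)⟩
  obtain ⟨τ, hτ, hτ'⟩ := exists_integralClosure_eq_trace (hf.map _) hfm' hN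
    (Y := Y) (by
      have : IsScalarTower R (R ⧸ p) (Matrix ι ι Q') := Matrix.isScalarTower
      rwa [aeval_map_algebraMap])
  exact mul_dvd_mul_of_isIntegral h1 hz hab hτ (by rwa [hτ'])

lemma dvd_mul_of_mem_maximalIdeal
    (h1 : ∀ x : integralClosure (R ⧸ p) Q', ¬IsUnit x →
      π γt * (x : Q') ∈ (algebraMap (R ⧸ p) Q').range)
    {z : R} (hz : ∀ r : R, r * z = 0 ↔ r ∈ p) {a b : R}
    (hab : algebraMap R Q b * (algebraMap R Q z * γt) = algebraMap R Q a)
    {r : R} (hr : r ∈ IsLocalRing.maximalIdeal R) : b ∣ a * r := by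
  have h := mul_dvd_mul_of_trace h1 hz hab (Y := algebraMap R (Matrix Unit Unit Q') r)
    (monic_X_sub_C r) ⟨fun {n} hn => ?_⟩ one_pos (by simp) (d := 1) (t := r)
    (by simp [Matrix.algebraMap_eq_diagonal])
  · rwa [mul_one] at h
  · rw [natDegree_X_sub_C, Nat.lt_one_iff] at hn
    simpa [hn] using hr

lemma mul_dvd_mul_trace [IsNoetherianRing R] [IsAdicComplete (IsLocalRing.maximalIdeal R) R]
    (h1 : ∀ x : integralClosure (R ⧸ p) Q', ¬IsUnit x →
      π γt * (x : Q') ∈ (algebraMap (R ⧸ p) Q').range)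
    {z : R} (hz : ∀ r : R, r * z = 0 ↔ r ∈ p) {a b : R}
    (hab : algebraMap R Q b * (algebraMap R Q z * γt) = algebraMap R Q a)
    {M : Type*} [AddCommGroup M] [Module R M] [Module.Finite R M]
    (hind : IsIndecomposableModule R M) {φ : Module.End R M} (hφ : ¬ Function.Bijective φ)
    {n : ℕ} {α : M →ₗ[R] (Fin n → R)} {u : (Fin n → R) →ₗ[R] M} {d : R} (hd : d ∉ p)
    (hu : u ∘ₗ α = d • LinearMap.id) : b * d ∣ a * LinearMap.trace R _ (α ∘ₗ φ ∘ₗ u) := by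
  obtain ⟨N, hN⟩ := hind.exists_range_pow_le hφ
  have hN' : LinearMap.range (φ ^ (N + 1)) ≤
      IsLocalRing.maximalIdeal R • (⊤ : Submodule R M) := by
    rw [pow_succ]
    exact (LinearMap.range_comp_le_range _ _).trans hN
  obtain ⟨f, hf, -, hfc, hf0⟩ :=
    LinearMap.exists_monic_and_natDegree_eq_and_coeff_mem_pow_and_aeval_eq_zero R _ _ hN'
  have hd0 : algebraMap R Q' d ≠ 0 := by
    rw [IsScalarTower.algebraMap_apply R (R ⧸ p) Q', Ne, FaithfulSMul.algebraMap_eq_zero_iff]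
    exact fun h => hd (Ideal.Quotient.eq_zero_iff_mem.mp h)
  let T : Module.End R M →ₗ[R] Matrix (Fin n) (Fin n) R :=
    { toFun ψ := LinearMap.toMatrix' (α ∘ₗ ψ ∘ₗ u)
      map_add' ψ χ := by simp [LinearMap.add_comp, LinearMap.comp_add]
      map_smul' r ψ := by simp [LinearMap.smul_comp, LinearMap.comp_smul] }
  have hT (ψ χ : Module.End R M) : T ψ * T χ = d • T (ψ * χ) := by
    have h2 : (α ∘ₗ ψ ∘ₗ u) * (α ∘ₗ χ ∘ₗ u) = d • (α ∘ₗ (ψ * χ) ∘ₗ u) := by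
      ext j i
      have := LinearMap.congr_fun hu (χ (u (Pi.single j 1)))
      simp only [LinearMap.comp_apply, LinearMap.smul_apply, LinearMap.id_apply] at this
      simp [this]
    exact (LinearMap.toMatrix'_mul _ _).symm.trans ((congrArg _ h2).trans (map_smul _ _ _))
  have hTtr (ψ : Module.End R M) : (T ψ).trace = LinearMap.trace R _ (α ∘ₗ ψ ∘ₗ u) := by
    rw [← Matrix.trace_toLin'_eq]
    exact congrArg (LinearMap.trace R _) (Matrix.toLin'_toMatrix' (α ∘ₗ ψ ∘ₗ u))
  clear_value T
  let Ψ : Module.End R M →ₙₐ[R] Matrix (Fin n) (Fin n) Q' :=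
    { toFun ψ := (algebraMap R Q' d)⁻¹ • (T ψ).map (algebraMap R Q')
      map_smul' r ψ := by
        ext i j
        rw [map_smul]
        simp only [Matrix.smul_apply, Matrix.map_apply, smul_eq_mul, map_mul, MonoidHom.id_apply,
          Algebra.smul_def (A := Q') r]
        ring
      map_zero' := by simp
      map_add' ψ χ := by
        ext
        simp [mul_add]
      map_mul' ψ χ := by
        rw [smul_mul_smul_comm, ← Matrix.map_mul, hT]
        ext
        simp [mul_assoc, hd0] }
  have hΨ : Ψ φ * aeval (Ψ φ ^ (N + 1)) f = 0 := by
    have := map_mul_aeval Ψ φ (f.comp (X ^ (N + 1)))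
    rw [aeval_comp, aeval_comp, aeval_X_pow, aeval_X_pow, hf0, mul_zero, map_zero] at this
    exact this.symm
  refine mul_dvd_mul_of_trace h1 hz hab hf ⟨fun {i} hi => ?_⟩ N.succ_pos hΨ ?_
  · exact Ideal.pow_le_self (Nat.sub_ne_zero_of_lt hi) (hfc i)
  · change algebraMap R Q' d *
      ((algebraMap R Q' d)⁻¹ • (T φ).map (algebraMap R Q')).trace = _
    rw [Matrix.trace_smul, smul_eq_mul, mul_inv_cancel_left₀ hd0, ← hTtr]
    exact (AddMonoidHom.map_trace (algebraMap R Q') (T φ)).symm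

end Socle

open TensorProduct in
/-- Let `R` be a one-dimensional Gorenstein complete Noetherian local ring which is not
regular, `𝔭` a minimal prime, and let `γ = z·γ̃' ∉ R` be as produced in the text
(`π(γ̃')·m_{R̄'} ⊆ R' = R/𝔭`, `π(γ̃') ∉ R'`, `Ann_R(z) = 𝔭`).  Let `M` be an indecomposable
finitely generated maximal Cohen-Macaulay `R`-module which is not free and is locally free
at every nonmaximal prime.  Then there exists `g ∈ End_R(M)` with `g ⊗ Q` equal to
multiplication by `γ` on `M ⊗[R] Q`, and for any such `g` and any `h ∈ End_R(M)` which is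
not an automorphism, `h ∘ g` factors through a finitely generated free `R`-module. -/
theorem gamma_acts_and_socle_property
    (R : Type u) [CommRing R] [IsNoetherianRing R] [IsLocalRing R]
    [IsAdicComplete (IsLocalRing.maximalIdeal R) R]
    [HasExt.{u} (ModuleCat.{u} R)]
    (hdim : ringKrullDim R = 1) (hGor : IsGorensteinOneDim R)
    (hnotreg : ¬ IsRegularLocal R)
    (p : Ideal R) (hp : p ∈ minimalPrimes R)
    (Q : Type*) [CommRing Q] [Algebra R Q] [IsLocalization (nonZeroDivisors R) Q]
    (Q' : Type*) [Field Q'] [Algebra (R ⧸ p) Q'] [IsFractionRing (R ⧸ p) Q']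
    [Algebra R Q'] [IsScalarTower R (R ⧸ p) Q']
    (π : Q →ₐ[R] Q') (hπ : Function.Surjective π)
    (γt : Q)
    (h1 : ∀ x : integralClosure (R ⧸ p) Q', ¬IsUnit x →
      π γt * (x : Q') ∈ (algebraMap (R ⧸ p) Q').range)
    (h2 : π γt ∉ (algebraMap (R ⧸ p) Q').range)
    (z : R) (hz : ∀ r : R, r * z = 0 ↔ r ∈ p)
    (γ : Q) (hγdef : γ = algebraMap R Q z * γt)
    (hγ : γ ∉ (algebraMap R Q).range)
    (M : Type u) [AddCommGroup M] [Module R M] [Module.Finite R M]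
    (hMCM : (moduleDepth R M : WithBot ℕ∞) = ringKrullDim R)
    (hind : IsIndecomposableModule R M) (hnotfree : ¬ Module.Free R M)
    (hloc : ∀ (q : Ideal R) (_ : q.IsPrime), q ≠ IsLocalRing.maximalIdeal R →
      Module.Free (Localization.AtPrime q) (LocalizedModule q.primeCompl M)) :
    (∃ g : Module.End R M, LinearMap.baseChange Q (g : M →ₗ[R] M) =
        γ • (LinearMap.id : Q ⊗[R] M →ₗ[Q] Q ⊗[R] M)) ∧
    ∀ g : Module.End R M, LinearMap.baseChange Q (g : M →ₗ[R] M) =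
        γ • (LinearMap.id : Q ⊗[R] M →ₗ[Q] Q ⊗[R] M) →
      ∀ h : Module.End R M, ¬ Function.Bijective h →
        ∃ (n : ℕ) (a : M →ₗ[R] (Fin n → R)) (b : (Fin n → R) →ₗ[R] M),
          ((h ∘ₗ g : Module.End R M) : M →ₗ[R] M) = b ∘ₗ a := by
  have : Ring.KrullDimLE 1 R := (Ring.krullDimLE_iff).mpr hdim.le
  have : p.IsPrime := hp.1.1
  have : FaithfulSMul (R ⧸ p) Q' :=
    (faithfulSMul_iff_algebraMap_injective _ _).mpr (IsFractionRing.injective (R ⧸ p) Q')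
  obtain ⟨x, hxm, hxR⟩ := exists_isSMulRegular_of_moduleDepth_eq_one (hGor.1.trans hdim)
  have hx : x ∈ nonZeroDivisors R := mem_nonZeroDivisors_iff_right.mpr fun r hr =>
    hxR (by simpa [mul_comm] using hr)
  obtain ⟨y, hym, hyM⟩ := exists_isSMulRegular_of_moduleDepth_eq_one (hMCM.trans hdim)
  have hM (b : R) (hb : b ∈ nonZeroDivisors R) : IsSMulRegular M b :=
    isSMulRegular_of_mem_nonZeroDivisors hym hyM hb
  obtain ⟨k, hk⟩ := exists_pow_smul_id_mem_range_dualTensorHom hloc hxm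
  obtain ⟨n, α, u, hu⟩ := exists_factorization_of_mem_range_dualTensorHom hk
  have hd : x ^ k ∈ nonZeroDivisors R := pow_mem hx k
  have hdp : x ^ k ∉ p := fun h => notMem_nonZeroDivisors_of_mem_mem_minimalPrimes h hp hd
  have hα : Function.Injective α := fun v w hvw => hM _ hd <|
    (LinearMap.congr_fun hu v).trans <|
      (congrArg u hvw).trans (LinearMap.congr_fun hu w).symm
  obtain ⟨⟨a, b, hb⟩, hab⟩ := IsLocalization.surj (nonZeroDivisors R) γ
  rw [mul_comm] at hab
  have hab' := hab
  rw [hγdef] at hab'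
  refine ⟨?_, fun g hg h hh => ?_⟩
  · obtain ⟨g, hg⟩ := exists_smul_eq_of_forall_exists (hM b hb)
      (a • (LinearMap.id : Module.End R M)) fun v =>
        exists_smul_eq_of_forall_dvd hGor hx hxm hα hb fun y => by
          simpa using dvd_mul_of_mem_maximalIdeal h1 hz hab'
            (hind.apply_mem_maximalIdeal hnotfree y v)
    exact ⟨g, (baseChange_eq_smul_id_iff hM hb hab g).mpr hg⟩
  · exact exists_factorization_of_mem_range_dualTensorHom <|
      mul_mem_range_dualTensorHom hGor hx hxm hM hd hu.symm hb
        ((baseChange_eq_smul_id_iff hM hb hab g).mp hg) fun e =>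
          mul_dvd_mul_trace h1 hz hab' hind (hind.not_bijective_comp hh e) hdp hu.symm
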